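/- Let X ⊆ Y be finite subsets of ℝ^n, r > 0, and k ≥ 0 an integer with |X| ≥ k+1, suppose X^{k+1}_dis is r-dense in Y^{k+1}_dis, and let θ : Y → X be any function such that d(y, θ(y)) < r for all y ∈ Y and, for every t ≥ 0, if y is a vertex of L_{t,k}(Y) then θ(y) is a vertex of L_{t+2r,k}(X). Let (s, x) be a branch point of Γ_k(X), let (s_0, x_0) be a maximal branch point of Γ_k(Y) below (s, x) (regarded as an element of Γ_k(Y)), let b be a maximal branch point of Γ_k(X) below (s_0 + 2r, θ(x_0)), and let c be a maximal branch point of Γ_k(X) below (s + 2r, x). Then b ≼ c and (s, x) ≼ c ≼ (s + 2r, x). (This exhibits the homotopy θ_* i_* ≼ s_* with s_* homotopic to the identity, bounded by 2r.) -/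

import Mathlib

open scoped Classical

noncomputable section

namespace DataHomotopy

/-- Points of `ℝ^n` with the Euclidean metric. -/
abbrev Pt (n : ℕ) := EuclideanSpace ℝ (Fin n)

/-- `σ` is a simplex of the Vietoris–Rips complex `V_s(X)`: a nonempty subset of `X`
all of whose pairwise distances are at most `s`. -/
def IsVRSimplex {n : ℕ} (X : Finset (Pt n)) (s : ℝ) (σ : Finset (Pt n)) : Prop :=
  σ.Nonempty ∧ σ ⊆ X ∧ ∀ x ∈ σ, ∀ y ∈ σ, dist x y ≤ s

/-- `x` is a vertex of the Lesnick complex `L_{s,k}(X)`: `x ∈ X` and there are at least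
`k` points of `X`, distinct from `x`, within distance `s` of `x`. -/
def IsLVertex {n : ℕ} (X : Finset (Pt n)) (k : ℕ) (s : ℝ) (x : Pt n) : Prop :=
  x ∈ X ∧ ∃ S : Finset (Pt n), S ⊆ X ∧ x ∉ S ∧ k ≤ S.card ∧ ∀ x' ∈ S, dist x x' ≤ s

/-- `σ` is a simplex of the Lesnick complex `L_{s,k}(X)`: a Vietoris–Rips simplex all of
whose elements are vertices of `L_{s,k}(X)`. -/
def IsLSimplex {n : ℕ} (X : Finset (Pt n)) (k : ℕ) (s : ℝ) (σ : Finset (Pt n)) : Prop :=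
  IsVRSimplex X s σ ∧ ∀ x ∈ σ, IsLVertex X k s x

/-- `x` and `y` lie in the same component of `L_{s,k}(X)`: both are vertices, and they are
joined by a finite chain of vertices with consecutive distances at most `s`. -/
def SameComp {n : ℕ} (X : Finset (Pt n)) (k : ℕ) (s : ℝ) (x y : Pt n) : Prop :=
  IsLVertex X k s x ∧
    Relation.ReflTransGen (fun a b => IsLVertex X k s b ∧ dist a b ≤ s) x y

/-- `p = (s, x)` is an element of `Γ_k(X)`: `s ≥ 0` and `x` is a vertex of `L_{s,k}(X)`. -/
def InGamma {n : ℕ} (X : Finset (Pt n)) (k : ℕ) (p : ℝ × Pt n) : Prop :=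
  0 ≤ p.1 ∧ IsLVertex X k p.1 p.2

/-- The preorder on `Γ_k(X)`: `(s, x) ≼ (t, y)` iff `s ≤ t` and `x`, `y` lie in the same
component of `L_{t,k}(X)`. -/
def GammaLe {n : ℕ} (X : Finset (Pt n)) (k : ℕ) (p q : ℝ × Pt n) : Prop :=
  p.1 ≤ q.1 ∧ SameComp X k q.1 p.2 q.2

/-- `p = (t, x)` is a branch point of `Γ_k(X)`. -/
def IsBranch {n : ℕ} (X : Finset (Pt n)) (k : ℕ) (p : ℝ × Pt n) : Prop :=
  InGamma X k p ∧
    ((∃ s₀, s₀ < p.1 ∧ ∀ s, s₀ ≤ s → s < p.1 →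
        ∃ x₀ x₁ : Pt n, IsLVertex X k s x₀ ∧ IsLVertex X k s x₁ ∧
          ¬ SameComp X k s x₀ x₁ ∧ GammaLe X k (s, x₀) p ∧ GammaLe X k (s, x₁) p) ∨
      ¬ ∃ q : ℝ × Pt n, q.1 < p.1 ∧ InGamma X k q ∧ GammaLe X k q p)

/-- `c` is a least upper bound of `a` and `b` in `Γ_k(X)`. -/
def IsLUBIn {n : ℕ} (X : Finset (Pt n)) (k : ℕ) (a b c : ℝ × Pt n) : Prop :=
  InGamma X k c ∧ GammaLe X k a c ∧ GammaLe X k b c ∧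
    ∀ c', InGamma X k c' → GammaLe X k a c' → GammaLe X k b c' → GammaLe X k c c'

/-- `b` is a maximal branch point below `a` in `Γ_k(X)`. -/
def IsMaxBranchBelow {n : ℕ} (X : Finset (Pt n)) (k : ℕ) (b a : ℝ × Pt n) : Prop :=
  IsBranch X k b ∧ GammaLe X k b a ∧
    ∀ b', IsBranch X k b' → GammaLe X k b' a → GammaLe X k b' b

/-- The Euclidean distance on `(ℝ^n)^m ≅ ℝ^{nm}` between two `m`-tuples. -/
def tupleDist {n m : ℕ} (y x : Fin m → Pt n) : ℝ :=
  Real.sqrt (∑ i, dist (y i) (x i) ^ 2)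

/-- `X^m_dis` is `r`-dense in `Y^m_dis`: every `m`-tuple of pairwise distinct points of `Y`
is within distance `< r` (in `ℝ^{nm}`) of an `m`-tuple of pairwise distinct points of `X`. -/
def ConfigDense {n : ℕ} (X Y : Finset (Pt n)) (m : ℕ) (r : ℝ) : Prop :=
  ∀ y : Fin m → Pt n, (∀ i, y i ∈ Y) → Function.Injective y →
    ∃ x : Fin m → Pt n, (∀ i, x i ∈ X) ∧ Function.Injective x ∧ tupleDist y x < r

/-- `s` and `t` are consecutive phase-change numbers of `Y`: both are realized as distances
between points of `Y`, `s < t`, and no distance between points of `Y` lies strictly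
between `s` and `t`. -/
def IsPhasePair {n : ℕ} (Y : Finset (Pt n)) (s t : ℝ) : Prop :=
  (∃ a ∈ Y, ∃ b ∈ Y, dist a b = s) ∧ (∃ a ∈ Y, ∃ b ∈ Y, dist a b = t) ∧
    s < t ∧ ∀ a ∈ Y, ∀ b ∈ Y, dist a b ≤ s ∨ t ≤ dist a b

/-- `dS X k s x y = u - s`, where `u` is the least number `u ≥ s` such that `x` and `y`
lie in the same component of `L_{u,k}(X)`. -/
def dS {n : ℕ} (X : Finset (Pt n)) (k : ℕ) (s : ℝ) (x y : Pt n) : ℝ :=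
  sInf {u : ℝ | s ≤ u ∧ SameComp X k u x y} - s

lemma IsLVertex.mono {n : ℕ} {X : Finset (Pt n)} {k : ℕ} {s t : ℝ} (hst : s ≤ t) {x : Pt n}
    (h : IsLVertex X k s x) : IsLVertex X k t x :=
  let ⟨hx, S, hS, hxS, hk, hd⟩ := h
  ⟨hx, S, hS, hxS, hk, fun y hy => (hd y hy).trans hst⟩

lemma SameComp.mono {n : ℕ} {X : Finset (Pt n)} {k : ℕ} {s t : ℝ} (hst : s ≤ t) {x y : Pt n}
    (h : SameComp X k s x y) : SameComp X k t x y :=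
  ⟨h.1.mono hst, Relation.ReflTransGen.mono (fun _ _ hab => ⟨hab.1.mono hst, hab.2.trans hst⟩) _ _ h.2⟩

lemma SameComp.trans {n : ℕ} {X : Finset (Pt n)} {k : ℕ} {s : ℝ} {x y z : Pt n}
    (hxy : SameComp X k s x y) (hyz : SameComp X k s y z) : SameComp X k s x z :=
  ⟨hxy.1, hxy.2.trans hyz.2⟩

/-- A map moving points of `Y` by less than `r` and sending vertices of `L_{t,k}(Y)` to vertices
of `L_{t+2r,k}(X)` sends components into components. -/
lemma SameComp.map {n : ℕ} {X Y : Finset (Pt n)} {k : ℕ} {r t : ℝ} {θ : Pt n → Pt n}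
    (hθd : ∀ y ∈ Y, dist y (θ y) < r)
    (hθv : ∀ y, IsLVertex Y k t y → IsLVertex X k (t + 2 * r) (θ y))
    {x y : Pt n} (h : SameComp Y k t x y) : SameComp X k (t + 2 * r) (θ x) (θ y) := by
  obtain ⟨hx, hxy⟩ := h
  suffices IsLVertex Y k t y ∧ SameComp X k (t + 2 * r) (θ x) (θ y) from this.2
  induction hxy with
  | refl => exact ⟨hx, hθv _ hx, .refl⟩
  | @tail u v _ huv ih =>
    refine ⟨huv.1, ih.2.1, ih.2.2.tail ⟨hθv _ huv.1, ?_⟩⟩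
    have hu := hθd u ih.1.1
    have hv := hθd v huv.1.1
    have htri := dist_triangle4 (θ u) u v (θ v)
    rw [dist_comm (θ u) u] at htri
    linarith [huv.2]

theorem stmt18 {n : ℕ} (X Y : Finset (Pt n)) (hXY : X ⊆ Y) (r : ℝ) (hr : 0 < r)
    (k : ℕ) (hcard : k + 1 ≤ X.card) (hdense : ConfigDense X Y (k + 1) r)
    (θ : Pt n → Pt n)
    (hθX : ∀ y ∈ Y, θ y ∈ X) (hθd : ∀ y ∈ Y, dist y (θ y) < r)
    (hθv : ∀ t : ℝ, 0 ≤ t → ∀ y : Pt n, IsLVertex Y k t y →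
      IsLVertex X k (t + 2 * r) (θ y))
    (s : ℝ) (x : Pt n) (hbr : IsBranch X k (s, x))
    (s₀ : ℝ) (x₀ : Pt n) (h₀ : IsMaxBranchBelow Y k (s₀, x₀) (s, x))
    (b : ℝ × Pt n) (hbm : IsMaxBranchBelow X k b (s₀ + 2 * r, θ x₀))
    (c : ℝ × Pt n) (hcm : IsMaxBranchBelow X k c (s + 2 * r, x)) :
    GammaLe X k b c ∧ GammaLe X k (s, x) c ∧ GammaLe X k c (s + 2 * r, x) := by
  have hs : 0 ≤ s := hbr.1.1
  have hx : IsLVertex X k s x := hbr.1.2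
  have hst : s ≤ s + 2 * r := by linarith
  have hs₀ : s₀ + 2 * r ≤ s + 2 * r := add_le_add_left h₀.2.1.1 _
  have hθx : SameComp X k (s + 2 * r) (θ x₀) (θ x) := h₀.2.1.2.map hθd (hθv s hs)
  have hstep : dist (θ x) x ≤ s + 2 * r := by
    rw [dist_comm]
    linarith [hθd x (hXY hx.1)]
  have hθxx : SameComp X k (s + 2 * r) (θ x₀) x :=
    ⟨hθx.1, hθx.2.tail ⟨hx.mono hst, hstep⟩⟩
  exact ⟨hcm.2.2 b hbm.1 ⟨hbm.2.1.1.trans hs₀, (hbm.2.1.2.mono hs₀).trans hθxx⟩,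
    hcm.2.2 (s, x) hbr ⟨hst, hx.mono hst, .refl⟩, hcm.2.1⟩

end DataHomotopy
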